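/- Let f ∈ 𝔪² define an isolated hypersurface singularity (i.e. μ(f) < ∞). Multiplication by f induces a well-defined O-linear map m_f : O/J(f) → O/(𝔪·J(f)) (since f·J(f) ⊆ 𝔪·J(f)), and the kernel of m_f is a ℂ-vector space of dimension exactly τ(f). (This kernel is the module T⁰_•(X₀,𝔪) of non-liftable vector fields with values in 𝔪 of the semi-universal deformation with section; in particular dim_ℂ T⁰_•(X₀,𝔪) = dim_ℂ T⁰_•(X₀) = τ(f).) -/

import Mathlib

/-- Formal partial derivative of a multivariate power series with respect to variable `i`. -/
noncomputable def pd {n : ℕ} {R : Type*} [CommSemiring R] (i : Fin n)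
    (f : MvPowerSeries (Fin n) R) : MvPowerSeries (Fin n) R :=
  fun m => (m i + 1) • f (m + Finsupp.single i 1)

/-- The maximal ideal `(x₁, …, xₙ)` of `ℂ[[x₁,…,xₙ]]`. -/
noncomputable def mIdeal (n : ℕ) : Ideal (MvPowerSeries (Fin n) ℂ) :=
  Ideal.span (Set.range (MvPowerSeries.X : Fin n → MvPowerSeries (Fin n) ℂ))

/-- The Jacobian ideal `J(f) = (∂f/∂x₁, …, ∂f/∂xₙ)` of `f ∈ ℂ[[x₁,…,xₙ]]`. -/
noncomputable def jacIdeal {n : ℕ} (f : MvPowerSeries (Fin n) ℂ) :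
    Ideal (MvPowerSeries (Fin n) ℂ) :=
  Ideal.span (Set.range fun i : Fin n => pd i f)

open MvPowerSeries in
lemma pd_eq_pderiv {n : ℕ} (i : Fin n) (f : MvPowerSeries (Fin n) ℂ) :
    pd i f = pderiv ℂ i f := by
  ext m
  rw [coeff_pderiv]
  change (m i + 1) • f (m + Finsupp.single i 1) = f (m + Finsupp.single i 1) * _
  rw [nsmul_eq_mul, mul_comm]
  push_cast
  rfl

open MvPowerSeries in
lemma mem_mIdeal_iff {n : ℕ} (f : MvPowerSeries (Fin n) ℂ) :
    f ∈ mIdeal n ↔ constantCoeff f = 0 := by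
  classical
  constructor
  · intro hf
    have hle : mIdeal n ≤ RingHom.ker (constantCoeff (σ := Fin n) (R := ℂ)) := by
      rw [mIdeal, Ideal.span_le]
      rintro _ ⟨i, rfl⟩
      simp [RingHom.mem_ker]
    exact hle hf
  · intro hf
    have hex : ∀ m : Fin n →₀ ℕ, m ≠ 0 → ∃ i, m i ≠ 0 := fun m hm ↦ by
      by_contra! h
      exact hm (Finsupp.ext h)
    choose s hs using hex
    let g : Fin n → MvPowerSeries (Fin n) ℂ :=
      fun i m ↦ if h : m = 0 then 0 else if s m h = i then f m else 0
    have hg : f = ∑ i, g i := by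
      ext m
      rw [map_sum]
      change f m = ∑ i, g i m
      by_cases h : m = 0
      · subst h
        have hg0 : ∀ i ∈ Finset.univ, g i 0 = 0 := fun i _ ↦ dif_pos rfl
        exact Eq.trans hf (Finset.sum_eq_zero hg0).symm
      · simp [g, h]
    rw [hg]
    refine Ideal.sum_mem _ fun i _ ↦ ?_
    have hdvd : (X i : MvPowerSeries (Fin n) ℂ) ∣ g i := by
      rw [X_dvd_iff]
      intro m hm
      change g i m = 0
      by_cases h : m = 0
      · simp [g, h]
      · have : s m h ≠ i := by
          rintro rfl
          exact hs m h hm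
        simp [g, h, this]
    exact Ideal.mem_of_dvd _ hdvd (Ideal.subset_span ⟨i, rfl⟩)

open MvPowerSeries in
lemma isUnit_of_notMem_mIdeal {n : ℕ} {f : MvPowerSeries (Fin n) ℂ} (hf : f ∉ mIdeal n) :
    IsUnit f := by
  rw [mem_mIdeal_iff] at hf
  exact isUnit_iff_constantCoeff.mpr (isUnit_iff_ne_zero.mpr hf)

lemma mIdeal_ne_top (n : ℕ) : mIdeal n ≠ ⊤ := by
  rw [Ideal.ne_top_iff_one, mem_mIdeal_iff]
  simp

open MvPowerSeries in
lemma jacIdeal_le_mIdeal {n : ℕ} {f : MvPowerSeries (Fin n) ℂ} (hf : f ∈ mIdeal n ^ 2) :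
    jacIdeal f ≤ mIdeal n := by
  rw [jacIdeal, Ideal.span_le]
  rintro _ ⟨i, rfl⟩
  simp only [pd_eq_pderiv, SetLike.mem_coe]
  rw [pow_two] at hf
  refine Submodule.mul_induction_on hf (fun a ha b hb ↦ ?_) fun a b ha hb ↦ ?_
  · rw [Derivation.leibniz]
    exact add_mem (Ideal.mul_mem_right _ _ ha) (Ideal.mul_mem_right _ _ hb)
  · rw [map_add]
    exact add_mem ha hb

/-- Every element of the maximal ideal has a power in a finite-codimensional ideal. -/
lemma exists_pow_mem_of_finite {n : ℕ} {I : Ideal (MvPowerSeries (Fin n) ℂ)}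
    (hI : Module.Finite ℂ (MvPowerSeries (Fin n) ℂ ⧸ I))
    {x : MvPowerSeries (Fin n) ℂ} (hx : x ∈ mIdeal n) : ∃ k, x ^ k ∈ I := by
  have : IsArtinian (MvPowerSeries (Fin n) ℂ) (MvPowerSeries (Fin n) ℂ ⧸ I) :=
    isArtinian_of_tower ℂ inferInstance
  obtain ⟨k, y, hy⟩ :=
    IsArtinian.exists_pow_succ_smul_dvd x (1 : MvPowerSeries (Fin n) ℂ ⧸ I)
  obtain ⟨y, rfl⟩ := Ideal.Quotient.mk_surjective y
  refine ⟨k, ?_⟩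
  have hmem : x ^ k * (1 - x * y) ∈ I := by
    rw [← Ideal.Quotient.eq_zero_iff_mem]
    have h : Ideal.Quotient.mk I (x ^ (k + 1) * y) = Ideal.Quotient.mk I (x ^ k * 1) := hy
    rw [show x ^ k * (1 - x * y) = x ^ k * 1 - x ^ (k + 1) * y by ring, map_sub, h, sub_self]
  have hu : IsUnit (1 - x * y) := by
    refine isUnit_of_notMem_mIdeal fun h ↦ mIdeal_ne_top n ?_
    rw [Ideal.eq_top_iff_one]
    simpa using add_mem h (Ideal.mul_mem_right y _ hx)
  exact (Ideal.mul_unit_mem_iff_mem I hu).mp hmem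

lemma Derivation.apply_mem_of_mem_span {R A : Type*} [CommRing R] [CommRing A] [Algebra R A]
    (D : Derivation R A A) {s : Set A} (hs : ∀ a ∈ s, D a ∈ Ideal.span s) {a : A}
    (ha : a ∈ Ideal.span s) : D a ∈ Ideal.span s := by
  induction ha using Submodule.span_induction with
  | mem a h => exact hs a h
  | zero => simp
  | add a b _ _ iha ihb =>
    rw [map_add]
    exact add_mem iha ihb
  | smul r a ha iha =>
    rw [smul_eq_mul, D.leibniz]
    exact add_mem (Ideal.mul_mem_left _ _ iha) (Ideal.mul_mem_right _ _ ha)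

/-- A derivation preserving a proper ideal of finite codimension maps each variable into the
maximal ideal. -/
lemma Derivation.apply_mem_mIdeal {n : ℕ}
    (D : Derivation ℂ (MvPowerSeries (Fin n) ℂ) (MvPowerSeries (Fin n) ℂ))
    {I : Ideal (MvPowerSeries (Fin n) ℂ)} (hne : I ≠ ⊤)
    (hI : Module.Finite ℂ (MvPowerSeries (Fin n) ℂ ⧸ I)) (hD : ∀ a ∈ I, D a ∈ I)
    {x : MvPowerSeries (Fin n) ℂ} (hx : x ∈ mIdeal n) : D x ∈ mIdeal n := by
  classical
  by_contra hu
  replace hu := isUnit_of_notMem_mIdeal hu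
  have hex := exists_pow_mem_of_finite hI hx
  obtain ⟨k, hk⟩ : ∃ k, Nat.find hex = k + 1 := by
    refine Nat.exists_eq_succ_of_ne_zero fun h0 ↦ hne ?_
    have := Nat.find_spec hex
    rw [h0, pow_zero] at this
    exact (Ideal.eq_top_iff_one I).mpr this
  have hmem := Nat.find_spec hex
  rw [hk] at hmem
  refine Nat.find_min hex (m := k) (by omega) ?_
  have h := hD _ hmem
  rw [D.leibniz_pow, Nat.add_sub_cancel, ← Nat.cast_smul_eq_nsmul ℂ, smul_eq_mul] at h
  have h2 := Submodule.smul_of_tower_mem I ((k + 1 : ℕ) : ℂ)⁻¹ h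
  rw [inv_smul_smul₀ (Nat.cast_ne_zero.mpr k.succ_ne_zero)] at h2
  exact (Ideal.mul_unit_mem_iff_mem I hu).mp h2

open MvPowerSeries in
lemma pderiv_comm {σ R : Type*} [CommSemiring R] (i j : σ) (f : MvPowerSeries σ R) :
    pderiv R i (pderiv R j f) = pderiv R j (pderiv R i f) := by
  classical
  ext m
  simp only [coeff_pderiv, Finsupp.add_apply, add_right_comm m (Finsupp.single i 1)]
  by_cases h : i = j
  · subst h
    ring
  · simp [h, Ne.symm h]
    ring

open MvPowerSeries in
lemma mul_mem_mIdeal_mul_jacIdeal {n : ℕ} {f : MvPowerSeries (Fin n) ℂ}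
    (hf : f ∈ mIdeal n ^ 2)
    (hmu : Module.Finite ℂ (MvPowerSeries (Fin n) ℂ ⧸ jacIdeal f))
    {x : MvPowerSeries (Fin n) ℂ} (hx : f * x ∈ jacIdeal f) :
    f * x ∈ mIdeal n * jacIdeal f := by
  classical
  obtain ⟨a, ha⟩ := Ideal.mem_span_range_iff_exists_fun.mp hx
  let D : Derivation ℂ (MvPowerSeries (Fin n) ℂ) (MvPowerSeries (Fin n) ℂ) :=
    ∑ i, a i • pderiv ℂ i
  have hDapp (g : MvPowerSeries (Fin n) ℂ) : D g = ∑ i, a i * pderiv ℂ i g := by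
    exact (congrFun (map_sum Derivation.coeFnAddMonoidHom (fun i ↦ a i • pderiv ℂ i)
      Finset.univ) g).trans (Finset.sum_apply _ _ _)
  have hDf : D f = f * x := by
    rw [hDapp, ← ha]
    simp only [pd_eq_pderiv]
  let s : Set (MvPowerSeries (Fin n) ℂ) := insert f (Set.range fun i ↦ pderiv ℂ i f)
  have hfs : f ∈ Ideal.span s := Ideal.subset_span (Set.mem_insert _ _)
  have hps (i : Fin n) : pderiv ℂ i f ∈ Ideal.span s :=
    Ideal.subset_span (Set.mem_insert_of_mem _ ⟨i, rfl⟩)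
  have hJs : jacIdeal f ≤ Ideal.span s := by
    rw [jacIdeal, Ideal.span_le]
    rintro _ ⟨i, rfl⟩
    simpa only [pd_eq_pderiv, SetLike.mem_coe] using hps i
  have hsm : Ideal.span s ≤ mIdeal n := by
    rw [Ideal.span_le]
    rintro _ (rfl | ⟨i, rfl⟩)
    · exact Ideal.pow_le_self two_ne_zero hf
    · refine jacIdeal_le_mIdeal hf ?_
      simp only [← pd_eq_pderiv]
      exact Ideal.subset_span ⟨i, rfl⟩
  have hfin : Module.Finite ℂ (MvPowerSeries (Fin n) ℂ ⧸ Ideal.span s) :=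
    Module.Finite.of_surjective (Ideal.Quotient.factorₐ ℂ hJs).toLinearMap
      (Ideal.Quotient.factor_surjective hJs)
  have hD : ∀ b ∈ Ideal.span s, D b ∈ Ideal.span s := by
    refine fun b hb ↦ D.apply_mem_of_mem_span ?_ hb
    rintro _ (rfl | ⟨j, rfl⟩)
    · rw [hDf]
      exact Ideal.mul_mem_right _ _ hfs
    · have hcomm : D (pderiv ℂ j f) =
          pderiv ℂ j (f * x) - ∑ i, pderiv ℂ i f * pderiv ℂ j (a i) := by
        rw [← hDf, hDapp, hDapp, map_sum, ← Finset.sum_sub_distrib]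
        refine Finset.sum_congr rfl fun i _ ↦ ?_
        rw [Derivation.leibniz, pderiv_comm, smul_eq_mul, smul_eq_mul, add_sub_cancel_right]
      rw [hcomm, Derivation.leibniz]
      exact sub_mem (add_mem (Ideal.mul_mem_right _ _ hfs) (Ideal.mul_mem_left _ _ (hps j)))
        (Ideal.sum_mem _ fun i _ ↦ Ideal.mul_mem_right _ _ (hps i))
  have hne : Ideal.span s ≠ ⊤ := fun h ↦ mIdeal_ne_top n (top_le_iff.mp (h ▸ hsm))
  rw [← ha]
  refine Ideal.sum_mem _ fun i _ ↦ Ideal.mul_mem_mul ?_ (Ideal.subset_span ⟨i, rfl⟩)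
  have hDX : D (X i) = a i := by
    rw [hDapp, Finset.sum_eq_single i]
    · simp
    · intro j _ hj
      simp [pderiv_X_of_ne hj.symm]
    · simp
  rw [← hDX]
  exact D.apply_mem_mIdeal hne hfin hD (Ideal.subset_span ⟨i, rfl⟩)

/-- The kernel of multiplication by `f` on a finite-dimensional quotient `A ⧸ J` has the dimension
of the cokernel. -/
lemma finrank_ker_mulLeft_quotient {K A : Type*} [Field K] [CommRing A] [Algebra K A]
    (J : Ideal A) (f : A) [Module.Finite K (A ⧸ J)] :
    Module.finrank K (LinearMap.ker (LinearMap.mulLeft K (Ideal.Quotient.mk J f))) =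
      Module.finrank K (A ⧸ (Ideal.span {f} + J)) := by
  let q := (Ideal.Quotient.factorₐ K (le_sup_right : J ≤ Ideal.span {f} ⊔ J)).toLinearMap
  have hq : Function.Surjective q := Ideal.Quotient.factor_surjective le_sup_right
  have hker : LinearMap.ker q = LinearMap.range (LinearMap.mulLeft K (Ideal.Quotient.mk J f)) := by
    ext v
    obtain ⟨v, rfl⟩ := Ideal.Quotient.mk_surjective v
    have hv : q (Ideal.Quotient.mk J v) = Ideal.Quotient.mk (Ideal.span {f} ⊔ J) v := rfl
    rw [LinearMap.mem_ker, hv, Ideal.Quotient.eq_zero_iff_mem, LinearMap.mem_range]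
    constructor
    · intro h
      obtain ⟨a, ha, b, hb, rfl⟩ := Submodule.mem_sup.mp h
      obtain ⟨c, rfl⟩ := Ideal.mem_span_singleton'.mp ha
      refine ⟨Ideal.Quotient.mk J c, ?_⟩
      rw [LinearMap.mulLeft_apply, map_add, Ideal.Quotient.eq_zero_iff_mem.mpr hb, add_zero,
        map_mul, mul_comm]
    · rintro ⟨w, hw⟩
      obtain ⟨w, rfl⟩ := Ideal.Quotient.mk_surjective w
      rw [LinearMap.mulLeft_apply, ← map_mul, Ideal.Quotient.eq] at hw
      rw [← sub_sub_cancel (f * w) v]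
      exact sub_mem (Submodule.mem_sup_left
        (Ideal.mul_mem_right _ _ (Ideal.mem_span_singleton_self f))) (Submodule.mem_sup_right hw)
  have h1 := LinearMap.finrank_range_add_finrank_ker (LinearMap.mulLeft K (Ideal.Quotient.mk J f))
  have h2 := LinearMap.finrank_range_add_finrank_ker q
  rw [LinearMap.range_eq_top.mpr hq, finrank_top, hker] at h2
  have h3 : Module.finrank K (A ⧸ (Ideal.span {f} ⊔ J)) =
    Module.finrank K (A ⧸ (Ideal.span {f} + J)) := rfl
  omega

/-- for `f ∈ 𝔪²` defining an isolated hypersurface singularity,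
multiplication by `f` induces a well-defined `O`-linear map
`m_f : O/J(f) → O/(𝔪·J(f))`, and the kernel of `m_f` (the module `T⁰_•(X₀,𝔪)` of
non-liftable vector fields with values in `𝔪`) is a ℂ-vector space of dimension exactly
`τ(f) = dim_ℂ O/((f) + J(f))`. -/
theorem kernel_mult_by_f_dim_tau (n : ℕ) (hn : 1 ≤ n)
    (f : MvPowerSeries (Fin n) ℂ)
    (hf2 : f ∈ (mIdeal n) ^ 2)
    (hmu : Module.Finite ℂ (MvPowerSeries (Fin n) ℂ ⧸ jacIdeal f)) :
    ∃ m_f : (MvPowerSeries (Fin n) ℂ ⧸ jacIdeal f) →ₗ[MvPowerSeries (Fin n) ℂ]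
        (MvPowerSeries (Fin n) ℂ ⧸ (mIdeal n * jacIdeal f)),
      (∀ x : MvPowerSeries (Fin n) ℂ,
        m_f (Ideal.Quotient.mk (jacIdeal f) x) =
          Ideal.Quotient.mk (mIdeal n * jacIdeal f) (f * x)) ∧
      Module.Finite ℂ (LinearMap.ker m_f) ∧
      Module.finrank ℂ (LinearMap.ker m_f) =
        Module.finrank ℂ
          (MvPowerSeries (Fin n) ℂ ⧸ (Ideal.span {f} + jacIdeal f)) := by
  have hle : jacIdeal f ≤
      Submodule.comap (LinearMap.mulLeft (MvPowerSeries (Fin n) ℂ) f)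
        (mIdeal n * jacIdeal f) :=
    fun x hx ↦ Ideal.mul_mem_mul (Ideal.pow_le_self two_ne_zero hf2) hx
  let m_f := Submodule.mapQ (jacIdeal f) (mIdeal n * jacIdeal f)
    (LinearMap.mulLeft (MvPowerSeries (Fin n) ℂ) f) hle
  have hm_f (x : MvPowerSeries (Fin n) ℂ) : m_f (Ideal.Quotient.mk (jacIdeal f) x) =
      Ideal.Quotient.mk (mIdeal n * jacIdeal f) (f * x) := rfl
  have hker : (LinearMap.ker m_f).restrictScalars ℂ =
      LinearMap.ker (LinearMap.mulLeft ℂ (Ideal.Quotient.mk (jacIdeal f) f)) := by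
    ext v
    obtain ⟨v, rfl⟩ := Ideal.Quotient.mk_surjective v
    rw [Submodule.restrictScalars_mem, LinearMap.mem_ker, LinearMap.mem_ker, hm_f,
      LinearMap.mulLeft_apply, ← map_mul, Ideal.Quotient.eq_zero_iff_mem,
      Ideal.Quotient.eq_zero_iff_mem]
    have hJ : mIdeal n * jacIdeal f ≤ jacIdeal f := Ideal.mul_le_right
    exact ⟨fun h ↦ hJ h, mul_mem_mIdeal_mul_jacIdeal hf2 hmu⟩
  refine ⟨m_f, hm_f, ?_, ?_⟩
  · exact inferInstanceAs (Module.Finite ℂ ((LinearMap.ker m_f).restrictScalars ℂ))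
  · rw [← finrank_ker_mulLeft_quotient, ← hker]
    rfl
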